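/- arXiv:math/0412325 — 2 statements merged into one kernel-verified Lean document; each statement's English description precedes it below -/
import Mathlib

section
/- The dimension of H^q in the cohomology of the infinite-dimensional Lie algebra m_0 at internal weight k + q(q+1)/2 equals P_q(k) - P_q(k-1), where P_q denotes the number of partitions into exactly q positive parts. -/
variable (K : Type*) [Field K] [CharZero K]

/-- The cochain `e^i` (for `i ≥ 1`) dual to the basis vector `e_i` of the Lie algebra
`m₀` (basis `e_1, e_2, ...`, brackets `[e_1, e_i] = e_{i+1}` for `i ≥ 2`); the cochain
complex of `m₀` is the exterior algebra on the span of the `e^i`, `i ≥ 1`. -/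
noncomputable def e (i : ℕ) : ExteriorAlgebra K (ℕ →₀ K) :=
  ExteriorAlgebra.ι K (Finsupp.single (i - 1) (1 : K))

/-- The monomial cochain `e^{i_1} ∧ ... ∧ e^{i_q}`. -/
noncomputable def mono (s : Finset ℕ) : ExteriorAlgebra K (ℕ →₀ K) :=
  ((s.sort (· ≤ ·)).map (e K)).prod

/-- `C^q_k`: the span of the `q`-cochains `e^{i_1} ∧ ... ∧ e^{i_q}`,
`1 ≤ i_1 < ... < i_q`, of weight `i_1 + ... + i_q = k`. -/
noncomputable def LamWt (q k : ℕ) : Submodule K (ExteriorAlgebra K (ℕ →₀ K)) :=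
  Submodule.span K {x | ∃ s : Finset ℕ,
    s.card = q ∧ (∀ i ∈ s, 1 ≤ i) ∧ (∑ i ∈ s, i) = k ∧ x = mono K s}

/-- `C^q`: the span of the `q`-cochains `e^{i_1} ∧ ... ∧ e^{i_q}` (all weights). -/
noncomputable def LamDeg (q : ℕ) : Submodule K (ExteriorAlgebra K (ℕ →₀ K)) :=
  Submodule.span K {x | ∃ s : Finset ℕ,
    s.card = q ∧ (∀ i ∈ s, 1 ≤ i) ∧ x = mono K s}

/-- `P q m`: the number of partitions of `m` into exactly `q` positive parts. -/
noncomputable def P (q m : ℕ) : ℕ :=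
  Fintype.card {p : Nat.Partition m // p.parts.card = q}

/-- Adds `c, c + 1, c + 2, ...` to the successive entries of a list. -/
def addStaircase : ℕ → List ℕ → List ℕ
  | _, [] => []
  | c, a :: l => (a + c) :: addStaircase (c + 1) l

theorem length_addStaircase (l : List ℕ) (c : ℕ) : (addStaircase c l).length = l.length := by
  induction l generalizing c with
  | nil => rfl
  | cons a l ih => simp [addStaircase, ih]

theorem two_mul_sum_addStaircase (l : List ℕ) (c : ℕ) :
    2 * (addStaircase c l).sum + l.length = 2 * l.sum + l.length * (2 * c + l.length) := by
  induction l generalizing c with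
  | nil => simp [addStaircase]
  | cons a l ih =>
    have h := ih (c + 1)
    simp only [addStaircase, List.sum_cons, List.length_cons]
    linarith

theorem sum_addStaircase_one (l : List ℕ) :
    (addStaircase 1 l).sum = l.sum + l.length * (l.length + 1) / 2 := by
  have h := two_mul_sum_addStaircase l 1
  have h' : l.length * (2 * 1 + l.length) = l.length * (l.length + 1) + l.length := by ring
  omega

theorem le_of_mem_addStaircase {l : List ℕ} {n c : ℕ} (h : ∀ a ∈ l, n ≤ a) :
    ∀ b ∈ addStaircase c l, n + c ≤ b := by
  induction l generalizing c with
  | nil => simp [addStaircase]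
  | cons a l ih =>
    simp only [List.mem_cons, forall_eq_or_imp, addStaircase] at h ⊢
    exact ⟨by omega, fun b hb => by have := ih h.2 b hb; omega⟩

theorem pairwise_lt_addStaircase {l : List ℕ} (c : ℕ) (h : l.Pairwise (· ≤ ·)) :
    (addStaircase c l).Pairwise (· < ·) := by
  induction l generalizing c with
  | nil => simp [addStaircase]
  | cons a l ih =>
    rw [List.pairwise_cons] at h
    refine List.pairwise_cons.2 ⟨fun b hb => ?_, ih _ h.2⟩
    have := le_of_mem_addStaircase h.1 b hb
    omega

theorem addStaircase_injective (c : ℕ) : Function.Injective (addStaircase c) := by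
  intro l
  induction l generalizing c with
  | nil => rintro (_ | _) <;> simp [addStaircase]
  | cons a l ih =>
    rintro (_ | ⟨b, m⟩)
    · simp [addStaircase]
    · intro h
      simp only [addStaircase, List.cons.injEq, add_left_inj] at h
      rw [h.1, ih _ h.2]

theorem exists_addStaircase_eq {l : List ℕ} (h : l.Pairwise (· < ·)) (c n : ℕ)
    (hl : ∀ b ∈ l, n + c ≤ b) :
    ∃ m : List ℕ, m.Pairwise (· ≤ ·) ∧ (∀ b ∈ m, n ≤ b) ∧ addStaircase c m = l := by
  induction l generalizing c n with
  | nil => exact ⟨[], by simp [addStaircase]⟩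
  | cons a l ih =>
    rw [List.pairwise_cons] at h
    simp only [List.mem_cons, forall_eq_or_imp] at hl
    obtain ⟨m, hm, hm', rfl⟩ := ih h.2 (c + 1) (a - c) fun b hb => by
      have := h.1 b hb
      omega
    refine ⟨(a - c) :: m, List.pairwise_cons.2 ⟨hm', hm⟩, ?_, ?_⟩
    · simp only [List.mem_cons, forall_eq_or_imp]
      exact ⟨by omega, fun b hb => le_trans (by omega) (hm' b hb)⟩
    · simp only [addStaircase, List.cons.injEq, and_true]
      omega

/-- The `q`-element sets of integers `≥ 2` whose sum is `w - c`. -/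
def setsGeTwo (q c w : ℕ) : Set (Finset ℕ) :=
  {s | s.card = q ∧ (∀ i ∈ s, 2 ≤ i) ∧ ∑ i ∈ s, i + c = w}

theorem setsGeTwo_succ_succ (q c w : ℕ) : setsGeTwo q (c + 1) (w + 1) = setsGeTwo q c w := by
  ext s
  simp only [setsGeTwo, Set.mem_ofPred_eq, ← add_assoc, add_left_inj]

theorem sum_toFinset_of_pairwise_lt {l : List ℕ} (h : l.Pairwise (· < ·)) :
    ∑ i ∈ l.toFinset, i = l.sum := by
  rw [List.sum_toFinset _ h.nodup, List.map_id']

theorem ncard_setsGeTwo (q k : ℕ) : (setsGeTwo q 0 (k + q * (q + 1) / 2)).ncard = P q k := by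
  have hlt (p : k.Partition) :=
    pairwise_lt_addStaircase 1 (Multiset.pairwise_sort p.parts (· ≤ ·))
  let f (p : {p : k.Partition // p.parts.card = q}) :
      setsGeTwo q 0 (k + q * (q + 1) / 2) :=
    ⟨(addStaircase 1 (p.1.parts.sort (· ≤ ·))).toFinset, by
      refine ⟨?_, ?_, ?_⟩
      · rw [List.toFinset_card_of_nodup (hlt p.1).nodup, length_addStaircase,
          Multiset.length_sort, p.2]
      · intro i hi
        refine le_of_mem_addStaircase (n := 1) (fun a ha => ?_) i (List.mem_toFinset.1 hi)
        exact p.1.parts_pos ((Multiset.mem_sort _).1 ha)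
      · rw [sum_toFinset_of_pairwise_lt (hlt p.1), sum_addStaircase_one, Multiset.length_sort,
          p.2, ← Multiset.sum_coe, Multiset.sort_eq, p.1.parts_sum, add_zero]⟩
  have hf : Function.Bijective f := by
    constructor
    · intro p p' h
      have h' : (addStaircase 1 (p.1.parts.sort (· ≤ ·))).toFinset =
        (addStaircase 1 (p'.1.parts.sort (· ≤ ·))).toFinset := congrArg Subtype.val h
      have h'' := congrArg (fun s : Finset ℕ => s.sort (· ≤ ·)) h'
      beta_reduce at h''
      rw [(List.toFinset_sort (· ≤ ·) (hlt p.1).nodup).2 ((hlt p.1).imp le_of_lt),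
        (List.toFinset_sort (· ≤ ·) (hlt p'.1).nodup).2 ((hlt p'.1).imp le_of_lt)] at h''
      have h₃ := addStaircase_injective 1 h''
      refine Subtype.ext (Nat.Partition.ext ?_)
      rw [← Multiset.sort_eq p.1.parts (· ≤ ·), h₃, Multiset.sort_eq]
    · rintro ⟨s, hcard, hge, hsum⟩
      obtain ⟨m, hm, hpos, hms⟩ := exists_addStaircase_eq (l := s.sort (· ≤ ·))
        (Finset.sortedLT_sort s).pairwise 1 1 fun b hb => hge b ((Finset.mem_sort _).1 hb)
      have hlen : m.length = q := by
        rw [← length_addStaircase m 1, hms, Finset.length_sort, hcard]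
      have hs : (addStaircase 1 m).toFinset = s := by rw [hms, Finset.sort_toFinset]
      have hmsum : m.sum = k := by
        have h₁ := sum_addStaircase_one m
        rw [hlen, ← sum_toFinset_of_pairwise_lt (pairwise_lt_addStaircase 1 hm), hs] at h₁
        omega
      refine ⟨⟨⟨(m : Multiset ℕ), fun {i} hi => hpos i hi, by simpa using hmsum⟩,
        by simpa using hlen⟩, Subtype.ext ?_⟩
      change (addStaircase 1 ((m : Multiset ℕ).sort (· ≤ ·))).toFinset = s
      rw [Multiset.coe_sort, List.mergeSort_eq_self _ (by simpa using hm), hs]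
  rw [P, ← Nat.card_eq_fintype_card, Nat.card_eq_of_bijective f hf,
    _root_.Nat.card_coe_set_eq]

section Monomials

variable (F : Type*) [Field F]

theorem mono_empty : mono F ∅ = 1 := by
  simp [mono]

theorem mono_insert {a : ℕ} {s : Finset ℕ} (h : ∀ b ∈ s, a < b) :
    mono F (insert a s) = e F a * mono F s := by
  rw [mono, Finset.sort_insert _ (fun b hb => (h b hb).le) fun ha => (h a ha).false,
    List.map_cons, List.prod_cons, mono]

theorem e_mem_LamDeg {i : ℕ} (hi : 1 ≤ i) : e F i ∈ LamDeg F 1 :=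
  Submodule.subset_span ⟨{i}, by simp, by simpa using hi, by simp [mono]⟩

theorem e_mul_self (i : ℕ) : e F i * e F i = 0 :=
  ExteriorAlgebra.ι_sq_zero _

theorem e_mul_e_swap (i j : ℕ) : e F i * e F j = -(e F j * e F i) :=
  eq_neg_of_add_eq_zero_left (ExteriorAlgebra.ι_add_mul_swap _ _)

theorem e_mul_e_mul_self (i : ℕ) (x : ExteriorAlgebra F (ℕ →₀ F)) :
    e F i * (e F i * x) = 0 := by
  rw [← mul_assoc, e_mul_self, zero_mul]

theorem e_mul_e_mul_swap (i j : ℕ) (x : ExteriorAlgebra F (ℕ →₀ F)) :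
    e F i * (e F j * x) = -(e F j * (e F i * x)) := by
  rw [← mul_assoc, e_mul_e_swap, neg_mul, mul_assoc]

theorem exists_e_mul_mono (i : ℕ) (s : Finset ℕ) :
    ∃ c : F, e F i * mono F s = c • mono F (insert i s) ∧ (i ∈ s → c = 0) := by
  induction s using Finset.induction_on_min with
  | empty => exact ⟨1, by simp [mono], by simp⟩
  | insert a t ha ih =>
    rcases lt_trichotomy i a with hia | rfl | hia
    · have hlt : ∀ b ∈ insert a t, i < b := by
        simp only [Finset.mem_insert, forall_eq_or_imp]
        exact ⟨hia, fun b hb => hia.trans (ha b hb)⟩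
      exact ⟨1, by rw [mono_insert F hlt, one_smul], fun h => absurd (hlt i h) (lt_irrefl i)⟩
    · exact ⟨0, by rw [mono_insert F ha, e_mul_e_mul_self, zero_smul], fun _ => rfl⟩
    · obtain ⟨c, hc, hc'⟩ := ih
      refine ⟨-c, ?_, fun h => ?_⟩
      · have hlt : ∀ b ∈ insert i t, a < b := by
          simp only [Finset.mem_insert, forall_eq_or_imp]
          exact ⟨hia, ha⟩
        rw [mono_insert F ha, e_mul_e_mul_swap, hc, Finset.insert_comm, mono_insert F hlt,
          mul_smul_comm, neg_smul]
      · rw [hc' ((Finset.mem_insert.1 h).resolve_left hia.ne'), neg_zero]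

theorem mono_map_succ (s : Finset ℕ) :
    mono F (s.map ⟨Nat.succ, Nat.succ_injective⟩) =
      (Finsupp.basisSingleOne (R := F) (ι := ℕ)).ExteriorAlgebra s := by
  have hsort : (s.map ⟨Nat.succ, Nat.succ_injective⟩).sort (· ≤ ·) =
      (s.sort (· ≤ ·)).map Nat.succ := by
    have hlt : ((s.sort (· ≤ ·)).map Nat.succ).Pairwise (· < ·) :=
      (Finset.sortedLT_sort s).pairwise.map _ fun _ _ => Nat.succ_lt_succ
    rw [← (List.toFinset_sort (· ≤ ·) hlt.nodup).2 (hlt.imp le_of_lt)]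
    congr 1
    ext
    simp
  rw [ExteriorAlgebra.basis_apply_ofCard _ rfl, ExteriorAlgebra.ιMulti_family,
    ExteriorAlgebra.ιMulti_apply, mono, hsort, ← Finset.listMap_orderEmbOfFin_finRange s rfl,
    List.ofFn_eq_map, List.map_map, List.map_map]
  congr 2

theorem linearIndepOn_mono : LinearIndepOn F (mono F) {s | ∀ i ∈ s, 1 ≤ i} := by
  have hrange : {s : Finset ℕ | ∀ i ∈ s, 1 ≤ i} =
      Set.range (Finset.map ⟨Nat.succ, Nat.succ_injective⟩) := by
    ext s
    constructor
    · intro hs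
      refine ⟨s.image Nat.pred, ?_⟩
      ext i
      simp only [Finset.mem_map, Finset.mem_image, Function.Embedding.coeFn_mk,
        exists_exists_and_eq_and]
      constructor
      · rintro ⟨j, hj, rfl⟩
        rwa [Nat.succ_pred_eq_of_pos (hs j hj)]
      · exact fun hi => ⟨i, hi, Nat.succ_pred_eq_of_pos (hs i hi)⟩
    · rintro ⟨t, rfl⟩ i hi
      obtain ⟨j, -, rfl⟩ := Finset.mem_map.1 hi
      exact Nat.succ_pos j
  rw [hrange, linearIndepOn_range_iff (Finset.map_injective _)]
  rw [show mono F ∘ Finset.map _ = _ from funext (mono_map_succ F)]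
  exact (Finsupp.basisSingleOne (R := F) (ι := ℕ)).ExteriorAlgebra.linearIndependent

/-- The span of the monomials indexed by a set of finsets. -/
noncomputable def monoSpan (S : Set (Finset ℕ)) : Submodule F (ExteriorAlgebra F (ℕ →₀ F)) :=
  Submodule.span F (mono F '' S)

variable {F}

theorem mono_mem_monoSpan {S : Set (Finset ℕ)} {s : Finset ℕ} (hs : s ∈ S) :
    mono F s ∈ monoSpan F S :=
  Submodule.subset_span (Set.mem_image_of_mem _ hs)

theorem monoSpan_le {S : Set (Finset ℕ)} {N : Submodule F (ExteriorAlgebra F (ℕ →₀ F))} :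
    monoSpan F S ≤ N ↔ ∀ s ∈ S, mono F s ∈ N := by
  rw [monoSpan, Submodule.span_le, Set.image_subset_iff]
  rfl

theorem monoSpan_mono {S T : Set (Finset ℕ)} (h : S ⊆ T) : monoSpan F S ≤ monoSpan F T :=
  Submodule.span_mono (Set.image_mono h)

theorem finrank_monoSpan {S : Set (Finset ℕ)} (hS : S.Finite) (hpos : ∀ s ∈ S, ∀ i ∈ s, 1 ≤ i) :
    Module.finrank F (monoSpan F S) = S.ncard := by
  have hli : LinearIndepOn F (mono F) S := (linearIndepOn_mono F).mono hpos
  have := (hS.image (mono F)).fintype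
  rw [monoSpan, finrank_span_set_eq_card hli.id_image, ← Set.ncard_eq_toFinset_card',
    hli.injOn.ncard_image]

end Monomials

theorem finite_setsGeTwo (q c w : ℕ) : (setsGeTwo q c w).Finite := by
  refine (Finset.range (w + 1)).powerset.finite_toSet.subset fun s hs => ?_
  rw [Finset.mem_coe, Finset.mem_powerset]
  intro i hi
  have := Finset.single_le_sum (f := fun j => j) (fun _ _ => Nat.zero_le _) hi
  have := hs.2.2
  exact Finset.mem_range.2 (by omega)

theorem one_lt_of_mem_setsGeTwo {q c w : ℕ} {s : Finset ℕ} (hs : s ∈ setsGeTwo q c w) :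
    ∀ i ∈ s, 1 < i :=
  hs.2.1

theorem one_notMem_of_mem_setsGeTwo {q c w : ℕ} {s : Finset ℕ} (hs : s ∈ setsGeTwo q c w) :
    1 ∉ s :=
  fun h => absurd (hs.2.1 1 h) (by norm_num)

theorem ncard_image_insert_one (q c w : ℕ) :
    (insert 1 '' setsGeTwo q c w).ncard = (setsGeTwo q c w).ncard := by
  refine Set.InjOn.ncard_image fun s hs t ht h => ?_
  rw [← Finset.erase_insert (one_notMem_of_mem_setsGeTwo hs), h,
    Finset.erase_insert (one_notMem_of_mem_setsGeTwo ht)]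

theorem one_mem_of_mem_image_insert_one {q c w : ℕ} {s : Finset ℕ}
    (hs : s ∈ insert 1 '' setsGeTwo q c w) : 1 ∈ s := by
  obtain ⟨t, -, rfl⟩ := hs
  exact Finset.mem_insert_self 1 t

theorem setsGeTwo_union_image_insert_one (q w : ℕ) :
    setsGeTwo (q + 1) 0 w ∪ insert 1 '' setsGeTwo q 1 w =
      {s | s.card = q + 1 ∧ (∀ i ∈ s, 1 ≤ i) ∧ ∑ i ∈ s, i = w} := by
  ext s
  constructor
  · rintro (hs | ⟨t, ht, rfl⟩)
    · exact ⟨hs.1, fun i hi => one_le_two.trans (hs.2.1 i hi), hs.2.2⟩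
    · have h1 := one_notMem_of_mem_setsGeTwo ht
      refine ⟨by rw [Finset.card_insert_of_notMem h1, ht.1], ?_, ?_⟩
      · simp only [Finset.mem_insert, forall_eq_or_imp]
        exact ⟨le_rfl, fun i hi => one_le_two.trans (ht.2.1 i hi)⟩
      · rw [Finset.sum_insert h1, add_comm, ht.2.2]
  · rintro ⟨hcard, hpos, hsum⟩
    by_cases h1 : 1 ∈ s
    · refine Or.inr ⟨s.erase 1, ⟨?_, fun i hi => ?_, ?_⟩, Finset.insert_erase h1⟩
      · rw [Finset.card_erase_of_mem h1, hcard, Nat.add_sub_cancel]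
      · have := hpos i (Finset.mem_of_mem_erase hi)
        have := Finset.ne_of_mem_erase hi
        omega
      · rw [Finset.sum_erase_add _ _ h1, hsum]
    · refine Or.inl ⟨hcard, fun i hi => ?_, hsum⟩
      have := hpos i hi
      have : i ≠ 1 := fun h => h1 (h ▸ hi)
      omega

section Differential

variable {F : Type*} [Field F]

theorem e_mul_mem_monoSpan {q c w i : ℕ} (hi : 2 ≤ i) {x : ExteriorAlgebra F (ℕ →₀ F)}
    (hx : x ∈ monoSpan F (setsGeTwo q c w)) :
    e F i * x ∈ monoSpan F (setsGeTwo (q + 1) c (w + i)) := by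
  suffices h : monoSpan F (setsGeTwo q c w) ≤
      (monoSpan F (setsGeTwo (q + 1) c (w + i))).comap (LinearMap.mulLeft F (e F i)) from h hx
  refine monoSpan_le.2 fun s hs => ?_
  obtain ⟨a, ha, ha'⟩ := exists_e_mul_mono F i s
  rw [Submodule.mem_comap, LinearMap.mulLeft_apply, ha]
  by_cases his : i ∈ s
  · rw [ha' his, zero_smul]
    exact Submodule.zero_mem _
  · refine Submodule.smul_mem _ _ (mono_mem_monoSpan ⟨?_, ?_, ?_⟩)
    · rw [Finset.card_insert_of_notMem his, hs.1]
    · simp only [Finset.mem_insert, forall_eq_or_imp]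
      exact ⟨hi, hs.2.1⟩
    · rw [Finset.sum_insert his, ← hs.2.2]
      ring

theorem map_mulLeft_e_one (q c w : ℕ) :
    (monoSpan F (setsGeTwo q c w)).map (LinearMap.mulLeft F (e F 1)) =
      monoSpan F (insert 1 '' setsGeTwo q c w) := by
  rw [monoSpan, Submodule.map_span, monoSpan, Set.image_image, Set.image_image]
  congr 1
  refine Set.image_congr fun s hs => ?_
  rw [LinearMap.mulLeft_apply, mono_insert F (one_lt_of_mem_setsGeTwo hs)]

theorem LamWt_succ (q w : ℕ) :
    LamWt F (q + 1) w =
      monoSpan F (setsGeTwo (q + 1) 0 w ∪ insert 1 '' setsGeTwo q 1 w) := by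
  rw [setsGeTwo_union_image_insert_one, LamWt, monoSpan]
  congr 1
  ext x
  constructor
  · rintro ⟨s, h1, h2, h3, rfl⟩
    exact ⟨s, ⟨h1, h2, h3⟩, rfl⟩
  · rintro ⟨s, ⟨h1, h2, h3⟩, rfl⟩
    exact ⟨s, h1, h2, h3, rfl⟩

theorem monoSpan_le_LamWt (q w : ℕ) :
    monoSpan F (setsGeTwo (q + 1) 0 w) ≤ LamWt F (q + 1) w := by
  rw [LamWt_succ]
  exact monoSpan_mono Set.subset_union_left

theorem finite_setsGeTwo_union (q w : ℕ) :
    (setsGeTwo (q + 1) 0 w ∪ insert 1 '' setsGeTwo q 1 w).Finite :=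
  (finite_setsGeTwo _ _ _).union ((finite_setsGeTwo _ _ _).image _)

instance finite_LamWt_succ (q w : ℕ) : Module.Finite F (LamWt F (q + 1) w) := by
  rw [LamWt_succ]
  exact Module.Finite.span_of_finite F ((finite_setsGeTwo_union q w).image _)

theorem finrank_LamWt_succ (q w : ℕ) :
    Module.finrank F (LamWt F (q + 1) w) =
      (setsGeTwo (q + 1) 0 w).ncard + (setsGeTwo q 1 w).ncard := by
  rw [LamWt_succ, finrank_monoSpan (finite_setsGeTwo_union q w), Set.ncard_union_eq _
    (finite_setsGeTwo _ _ _) ((finite_setsGeTwo _ _ _).image _), ncard_image_insert_one]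
  · exact Set.disjoint_left.2 fun s hs hs' =>
      one_notMem_of_mem_setsGeTwo hs (one_mem_of_mem_image_insert_one hs')
  · rw [setsGeTwo_union_image_insert_one]
    exact fun s hs => hs.2.1

theorem finrank_monoSpan_image_insert_one (q w : ℕ) :
    Module.finrank F (monoSpan F (insert 1 '' setsGeTwo q 1 w)) = (setsGeTwo q 1 w).ncard := by
  rw [finrank_monoSpan ((finite_setsGeTwo _ _ _).image _), ncard_image_insert_one]
  intro s hs
  have : s ∈ setsGeTwo (q + 1) 0 w ∪ insert 1 '' setsGeTwo q 1 w := Or.inr hs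
  rw [setsGeTwo_union_image_insert_one] at this
  exact this.2.1

/-- The values of the Chevalley–Eilenberg differential of `m₀` on `1` and on products with
a generator on the left; they determine the differential. -/
structure IsChevalleyEilenberg (d : Module.End F (ExteriorAlgebra F (ℕ →₀ F))) : Prop where
  map_one : d 1 = 0
  map_e_one_mul : ∀ x, d (e F 1 * x) = -(e F 1 * d x)
  map_e_two_mul : ∀ x, d (e F 2 * x) = -(e F 2 * d x)
  map_e_succ_mul : ∀ i, 2 ≤ i → ∀ x,
    d (e F (i + 1) * x) = e F 1 * (e F i * x) - e F (i + 1) * d x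

theorem IsChevalleyEilenberg.of_leibniz {d : Module.End F (ExteriorAlgebra F (ℕ →₀ F))}
    (hLeib : ∀ p : ℕ, ∀ x ∈ LamDeg F p, ∀ y,
      d (x * y) = d x * y + ((-1 : F) ^ p) • (x * d y))
    (h1 : d (e F 1) = 0) (h2 : d (e F 2) = 0)
    (hd : ∀ i, 2 ≤ i → d (e F (i + 1)) = e F 1 * e F i) : IsChevalleyEilenberg d where
  map_one := by
    have h := hLeib 0 1 (Submodule.subset_span ⟨∅, by simp, by simp, (mono_empty F).symm⟩) 1
    simpa using h
  map_e_one_mul x := by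
    rw [hLeib 1 _ (e_mem_LamDeg F le_rfl), h1]
    simp
  map_e_two_mul x := by
    rw [hLeib 1 _ (e_mem_LamDeg F one_le_two), h2]
    simp
  map_e_succ_mul i hi x := by
    rw [hLeib 1 _ (e_mem_LamDeg F (by omega)), hd i hi, mul_assoc]
    simp [sub_eq_add_neg]

namespace IsChevalleyEilenberg

variable {d : Module.End F (ExteriorAlgebra F (ℕ →₀ F))}

theorem map_mono_mem (hd : IsChevalleyEilenberg d) (s : Finset ℕ) (hs : ∀ i ∈ s, 2 ≤ i) :
    d (mono F s) ∈ monoSpan F (insert 1 '' setsGeTwo s.card 1 (∑ i ∈ s, i)) := by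
  induction s using Finset.induction_on_min with
  | empty => simp [mono_empty, hd.map_one]
  | insert a t ha ih =>
    simp only [Finset.mem_insert, forall_eq_or_imp] at hs
    have hat : a ∉ t := fun h => (ha a h).false
    have ih := ih hs.2
    rw [← map_mulLeft_e_one] at ih ⊢
    obtain ⟨y, hy, hdy⟩ := ih
    rw [LinearMap.mulLeft_apply] at hdy
    have hey := e_mul_mem_monoSpan hs.1 hy
    rw [mono_insert F ha, Finset.card_insert_of_notMem hat, Finset.sum_insert hat, add_comm a]
    obtain rfl | ⟨b, hb, rfl⟩ : a = 2 ∨ ∃ b, 2 ≤ b ∧ a = b + 1 := by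
      rcases hs.1.eq_or_lt with h | h
      · exact Or.inl h.symm
      · exact Or.inr ⟨a - 1, by omega, by omega⟩
    · refine ⟨e F 2 * y, hey, ?_⟩
      rw [hd.map_e_two_mul, ← hdy, LinearMap.mulLeft_apply, e_mul_e_mul_swap]
    · have hbt : mono F t ∈ monoSpan F (setsGeTwo t.card 0 (∑ i ∈ t, i)) :=
        mono_mem_monoSpan ⟨rfl, hs.2, rfl⟩
      have hbt := e_mul_mem_monoSpan hb hbt
      rw [← setsGeTwo_succ_succ] at hbt
      refine ⟨e F b * mono F t + e F (b + 1) * y, Submodule.add_mem _ hbt hey, ?_⟩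
      rw [hd.map_e_succ_mul b hb, ← hdy, LinearMap.mulLeft_apply, mul_add,
        e_mul_e_mul_swap F (b + 1), sub_neg_eq_add]

theorem map_mem (hd : IsChevalleyEilenberg d) {q w : ℕ} {x : ExteriorAlgebra F (ℕ →₀ F)}
    (hx : x ∈ monoSpan F (setsGeTwo q 0 w)) :
    d x ∈ monoSpan F (insert 1 '' setsGeTwo q 1 w) := by
  suffices h : monoSpan F (setsGeTwo q 0 w) ≤
      (monoSpan F (insert 1 '' setsGeTwo q 1 w)).comap d from h hx
  refine monoSpan_le.2 ?_
  rintro s ⟨rfl, hs, rfl⟩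
  exact hd.map_mono_mem s hs

theorem e_one_mul_e_mul_mem (hd : IsChevalleyEilenberg d) {q i : ℕ} (v : ℕ) (hi : 2 ≤ i)
    {x : ExteriorAlgebra F (ℕ →₀ F)}
    (hx : x ∈ monoSpan F (setsGeTwo q 0 v)) :
    e F 1 * (e F i * x) ∈ (monoSpan F (setsGeTwo (q + 1) 0 (v + i + 1))).map d := by
  induction v generalizing i x with
  | zero =>
    have hdx := hd.map_mem hx
    have hempty : setsGeTwo q 1 0 = ∅ :=
      Set.eq_empty_of_forall_notMem fun s hs => by
        have := hs.2.2
        omega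
    rw [hempty, Set.image_empty, monoSpan, Set.image_empty, Submodule.span_empty,
      Submodule.mem_bot] at hdx
    have hmem : e F (i + 1) * x ∈ monoSpan F (setsGeTwo (q + 1) 0 (0 + (i + 1))) :=
      e_mul_mem_monoSpan (by omega) hx
    rw [← add_assoc] at hmem
    refine ⟨_, hmem, ?_⟩
    rw [hd.map_e_succ_mul i hi, hdx, mul_zero, sub_zero]
  | succ u ih =>
    have hdx := hd.map_mem hx
    rw [setsGeTwo_succ_succ, ← map_mulLeft_e_one] at hdx
    obtain ⟨y, hy, hdy⟩ := hdx
    rw [LinearMap.mulLeft_apply] at hdy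
    have hmem : d (e F (i + 1) * x) ∈
        (monoSpan F (setsGeTwo (q + 1) 0 (u + 1 + (i + 1)))).map d :=
      Submodule.mem_map_of_mem (e_mul_mem_monoSpan (by omega) hx)
    rw [← add_assoc] at hmem
    have hy' := ih (i := i + 1) (by omega) hy
    rw [show u + (i + 1) + 1 = u + 1 + i + 1 by ring] at hy'
    have h := Submodule.sub_mem _ hmem hy'
    rwa [hd.map_e_succ_mul i hi, ← hdy, e_mul_e_mul_swap F (i + 1), sub_neg_eq_add,
      add_sub_cancel_right] at h

theorem map_LamWt_succ (hd : IsChevalleyEilenberg d) (q w : ℕ) :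
    (LamWt F (q + 1) w).map d = monoSpan F (insert 1 '' setsGeTwo (q + 1) 1 w) := by
  apply le_antisymm
  · rw [LamWt_succ, Submodule.map_le_iff_le_comap, monoSpan_le]
    rintro s (hs | ⟨t, ht, rfl⟩)
    · exact hd.map_mem (mono_mem_monoSpan hs)
    · obtain ⟨y, -, hy⟩ : d (mono F t) ∈ (monoSpan F (setsGeTwo t.card 1 (∑ i ∈ t, i))).map
          (LinearMap.mulLeft F (e F 1)) := by
        rw [map_mulLeft_e_one]
        exact hd.map_mono_mem t ht.2.1
      rw [Submodule.mem_comap, mono_insert F (one_lt_of_mem_setsGeTwo ht), hd.map_e_one_mul, ← hy,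
        LinearMap.mulLeft_apply, e_mul_e_mul_self, neg_zero]
      exact Submodule.zero_mem _
  · rw [monoSpan_le]
    rintro _ ⟨s, hs, rfl⟩
    refine Submodule.map_mono (monoSpan_le_LamWt q w) ?_
    rw [mono_insert F (one_lt_of_mem_setsGeTwo hs)]
    obtain ⟨hcard, hge, hsum⟩ := hs
    induction s using Finset.induction_on_min with
    | empty => simp at hcard
    | insert a t ha _ =>
      simp only [Finset.mem_insert, forall_eq_or_imp] at hge
      have hat : a ∉ t := fun h => (ha a h).false
      rw [Finset.card_insert_of_notMem hat, add_left_inj] at hcard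
      rw [Finset.sum_insert hat, add_comm a] at hsum
      rw [mono_insert F ha, ← hsum]
      exact hd.e_one_mul_e_mul_mem _ hge.1 (mono_mem_monoSpan ⟨hcard, hge.2, rfl⟩)

theorem finrank_map_LamWt_succ (hd : IsChevalleyEilenberg d) (q w : ℕ) :
    Module.finrank F ((LamWt F (q + 1) w).map d) = (setsGeTwo (q + 1) 1 w).ncard := by
  rw [hd.map_LamWt_succ, finrank_monoSpan_image_insert_one]

theorem finrank_LamWt_inf_ker_succ (hd : IsChevalleyEilenberg d) (q w : ℕ) :
    Module.finrank F ↥(LamWt F (q + 1) w ⊓ LinearMap.ker d) + (setsGeTwo (q + 1) 1 w).ncard =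
      (setsGeTwo (q + 1) 0 w).ncard + (setsGeTwo q 1 w).ncard := by
  have h := LinearMap.finrank_range_add_finrank_ker (d.domRestrict (LamWt F (q + 1) w))
  rw [LinearMap.range_domRestrict, hd.finrank_map_LamWt_succ, finrank_LamWt_succ,
    LinearMap.ker_domRestrict] at h
  rw [← h, add_comm, (Submodule.equivSubtypeMap _ _).finrank_eq, Submodule.map_comap_subtype]

end IsChevalleyEilenberg

end Differential

/-- For the Chevalley–Eilenberg differential `d` of `m₀` (the odd derivation with
`d e^1 = d e^2 = 0`, `d e^{i+1} = e^1 ∧ e^i` for `i ≥ 2`), the dimension of the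
cohomology `H^q` in internal weight `k + q(q+1)/2` equals `P_q(k) - P_q(k-1)`. -/
theorem stmt7 (d : Module.End K (ExteriorAlgebra K (ℕ →₀ K)))
    (hLeib : ∀ p : ℕ, ∀ x ∈ LamDeg K p, ∀ y,
      d (x * y) = d x * y + ((-1 : K) ^ p) • (x * d y))
    (h1 : d (e K 1) = 0) (h2 : d (e K 2) = 0)
    (hd : ∀ i, 2 ≤ i → d (e K (i + 1)) = e K 1 * e K i)
    (q k : ℕ) (hq : 2 ≤ q) :
    Module.finrank K ↥(LamWt K q (k + q * (q + 1) / 2) ⊓ LinearMap.ker d) -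
      Module.finrank K ↥((LamWt K (q - 1) (k + q * (q + 1) / 2)).map d) =
        P q k - P q (k - 1) := by
  obtain ⟨n, rfl⟩ : ∃ n, q = n + 2 := ⟨q - 2, by omega⟩
  have hCE := IsChevalleyEilenberg.of_leibniz hLeib h1 h2 hd
  have hZ : Module.finrank K ↥(LamWt K (n + 2) (k + (n + 2) * (n + 2 + 1) / 2) ⊓
        LinearMap.ker d) + (setsGeTwo (n + 2) 1 (k + (n + 2) * (n + 2 + 1) / 2)).ncard =
      (setsGeTwo (n + 2) 0 (k + (n + 2) * (n + 2 + 1) / 2)).ncard +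
        (setsGeTwo (n + 1) 1 (k + (n + 2) * (n + 2 + 1) / 2)).ncard :=
    hCE.finrank_LamWt_inf_ker_succ (n + 1) _
  have hB := hCE.finrank_map_LamWt_succ n (k + (n + 2) * (n + 2 + 1) / 2)
  rw [ncard_setsGeTwo] at hZ
  rw [show n + 2 - 1 = n + 1 from rfl, hB]
  cases k with
  | zero =>
    have hP : P (n + 2) 0 = 0 := by
      rw [P, Fintype.card_eq_zero_iff]
      exact ⟨fun p => by simpa using p.2⟩
    omega
  | succ k =>
    rw [Nat.add_right_comm, setsGeTwo_succ_succ (n + 2), ncard_setsGeTwo] at hZ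
    rw [Nat.add_right_comm, Nat.add_sub_cancel]
    omega
end

section
/- H^2(m_2) is two-dimensional, spanned by the classes of the cocycles e^2 ∧ e^3 (weight 5) and e^3 ∧ e^4 - e^2 ∧ e^5 (weight 7). -/
variable (K : Type*) [Field K] [CharZero K]

/-- Pairing of a cochain with the bivector `f ∧ g`. -/
noncomputable def pairTwo (f g : Module.Dual K (ℕ →₀ K)) :
    ExteriorAlgebra K (ℕ →₀ K) →ₗ[K] K :=
  (ExteriorAlgebra.algebraMapInv (R := K) (M := ℕ →₀ K)).toLinearMap ∘ₗ
    CliffordAlgebra.contractLeft (Q := (0 : QuadraticForm K (ℕ →₀ K))) g ∘ₗ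
    CliffordAlgebra.contractLeft (Q := (0 : QuadraticForm K (ℕ →₀ K))) f

/-- Pairing of a cochain with the trivector `f ∧ g ∧ h`. -/
noncomputable def pairThree (f g h : Module.Dual K (ℕ →₀ K)) :
    ExteriorAlgebra K (ℕ →₀ K) →ₗ[K] K :=
  pairTwo K g h ∘ₗ CliffordAlgebra.contractLeft (Q := (0 : QuadraticForm K (ℕ →₀ K))) f

omit [CharZero K] in
theorem contractLeft_ι_mul_exterior (f : Module.Dual K (ℕ →₀ K)) (x : ℕ →₀ K)
    (b : ExteriorAlgebra K (ℕ →₀ K)) :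
    CliffordAlgebra.contractLeft (Q := (0 : QuadraticForm K (ℕ →₀ K))) f
      (ExteriorAlgebra.ι K x * b) = f x • b - ExteriorAlgebra.ι K x *
        CliffordAlgebra.contractLeft (Q := (0 : QuadraticForm K (ℕ →₀ K))) f b :=
  CliffordAlgebra.contractLeft_ι_mul _ _ _

omit [CharZero K] in
theorem contractLeft_ι_exterior (f : Module.Dual K (ℕ →₀ K)) (x : ℕ →₀ K) :
    CliffordAlgebra.contractLeft (Q := (0 : QuadraticForm K (ℕ →₀ K))) f
      (ExteriorAlgebra.ι K x) = algebraMap K _ (f x) :=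
  CliffordAlgebra.contractLeft_ι _ _ _

omit [CharZero K] in
theorem pairTwo_ι_mul_ι (f g : Module.Dual K (ℕ →₀ K)) (x y : ℕ →₀ K) :
    pairTwo K f g (ExteriorAlgebra.ι K x * ExteriorAlgebra.ι K y) = f x * g y - f y * g x := by
  have h : ∀ r : K, ExteriorAlgebra.algebraMapInv (M := ℕ →₀ K) (algebraMap K _ r) = r :=
    ExteriorAlgebra.algebraMap_leftInverse _
  simp [pairTwo, contractLeft_ι_mul_exterior,
    ← Algebra.commutes, ← Algebra.smul_def, h]

omit [CharZero K] in
theorem pairThree_ι_mul_ι_mul_ι (f g h : Module.Dual K (ℕ →₀ K)) (x y z : ℕ →₀ K) :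
    pairThree K f g h
      (ExteriorAlgebra.ι K x * ExteriorAlgebra.ι K y * ExteriorAlgebra.ι K z) =
      f x * (g y * h z - g z * h y) - f y * (g x * h z - g z * h x) +
        f z * (g x * h y - g y * h x) := by
  simp only [pairThree, LinearMap.comp_apply, mul_assoc, contractLeft_ι_mul_exterior,
    contractLeft_ι_exterior, mul_sub, map_sub, map_smul, pairTwo_ι_mul_ι,
    ← Algebra.commutes (R := K), ← Algebra.smul_def, mul_smul_comm, smul_eq_mul]
  ring

omit [CharZero K] in
theorem mono_pair {p q : ℕ} (h : p < q) : mono K {p, q} = e K p * e K q := by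
  have : ({p, q} : Finset ℕ).sort (· ≤ ·) = [p, q] := by
    rw [Finset.sort_insert] <;> simp <;> omega
  simp [mono, this]

omit [CharZero K] in
theorem LamDeg_one : LamDeg K 1 = Submodule.span K {x | ∃ p, 1 ≤ p ∧ x = e K p} := by
  unfold LamDeg
  congr 1
  ext x
  constructor
  · rintro ⟨s, hs, h, rfl⟩
    obtain ⟨p, rfl⟩ := Finset.card_eq_one.mp hs
    exact ⟨p, h p (by simp), by simp [mono]⟩
  · rintro ⟨p, h, rfl⟩
    exact ⟨{p}, by simp, by simpa using h, by simp [mono]⟩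

omit [CharZero K] in
theorem LamDeg_two : LamDeg K 2 =
    Submodule.span K {x | ∃ p q, 1 ≤ p ∧ p < q ∧ x = e K p * e K q} := by
  unfold LamDeg
  congr 1
  ext x
  constructor
  · rintro ⟨s, hs, h, rfl⟩
    obtain ⟨p, q, hpq, rfl⟩ := Finset.card_eq_two.mp hs
    rcases lt_or_gt_of_ne hpq with hlt | hlt
    · exact ⟨p, q, h p (by simp), hlt, mono_pair K hlt⟩
    · exact ⟨q, p, h q (by simp), hlt, by rw [Finset.pair_comm, mono_pair K hlt]⟩
  · rintro ⟨p, q, hp, hlt, rfl⟩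
    refine ⟨{p, q}, Finset.card_pair hlt.ne, ?_, (mono_pair K hlt).symm⟩
    simp only [Finset.mem_insert, Finset.mem_singleton]
    omega

omit [CharZero K] in
theorem e_mul_self_s17 (p : ℕ) : e K p * e K p = 0 := ExteriorAlgebra.ι_sq_zero _

omit [CharZero K] in
theorem e_mul_swap (p q : ℕ) : e K p * e K q = -(e K q * e K p) :=
  eq_neg_of_add_eq_zero_left (ExteriorAlgebra.ι_add_mul_swap _ _)

/-- The coordinate functional dual to `e^i`. -/
noncomputable def coord (i : ℕ) : Module.Dual K (ℕ →₀ K) := Finsupp.lapply (i - 1)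

/-- The covector underlying `e^i`. -/
noncomputable def covec (i : ℕ) : ℕ →₀ K := Finsupp.single (i - 1) 1

/-- The transpose of `ad e_1`, for which `e^1 ∧ adOneDual p` is a summand of `d e^p`. -/
noncomputable def adOneDual (p : ℕ) : ℕ →₀ K := if 3 ≤ p then covec K (p - 1) else 0

/-- The transpose of `ad e_2` restricted to `e_3, e_4, ...`, for which `e^2 ∧ adTwoDual p` is a
summand of `d e^p`. -/
noncomputable def adTwoDual (p : ℕ) : ℕ →₀ K := if 5 ≤ p then covec K (p - 2) else 0

omit [CharZero K] in
theorem coord_covec {i p : ℕ} (hi : 1 ≤ i) (hp : 1 ≤ p) :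
    coord K i (covec K p) = if p = i then 1 else 0 := by
  simp only [coord, covec, Finsupp.lapply_apply, Finsupp.single_apply]
  congr 1
  simp only [eq_iff_iff]
  omega

omit [CharZero K] in
theorem coord_adOneDual {i p : ℕ} (hi : 1 ≤ i) (hp : 1 ≤ p) :
    coord K i (adOneDual K p) = if 2 ≤ i then coord K (i + 1) (covec K p) else 0 := by
  unfold adOneDual
  rw [coord_covec K (by omega) hp]
  split_ifs <;> first | omega | simp | skip
  all_goals
    rw [coord_covec K hi (by omega)]
    split_ifs <;> first | omega | rfl

omit [CharZero K] in
theorem coord_adTwoDual {i p : ℕ} (hi : 1 ≤ i) (hp : 1 ≤ p) :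
    coord K i (adTwoDual K p) = if 3 ≤ i then coord K (i + 2) (covec K p) else 0 := by
  unfold adTwoDual
  rw [coord_covec K (by omega) hp]
  split_ifs <;> first | omega | simp | skip
  all_goals
    rw [coord_covec K hi (by omega)]
    split_ifs <;> first | omega | rfl

/-- The coefficient of `e^i ∧ e^j`. -/
noncomputable def coeffTwo (i j : ℕ) : ExteriorAlgebra K (ℕ →₀ K) →ₗ[K] K :=
  pairTwo K (coord K i) (coord K j)

omit [CharZero K] in
theorem coeffTwo_e_mul_e {i j p q : ℕ} (hi : 1 ≤ i) (hj : 1 ≤ j) (hp : 1 ≤ p) (hq : 1 ≤ q) :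
    coeffTwo K i j (e K p * e K q) =
      (if p = i then 1 else 0) * (if q = j then 1 else 0) -
        (if q = i then 1 else 0) * (if p = j then 1 else 0) := by
  rw [← coord_covec K hi hp, ← coord_covec K hi hq, ← coord_covec K hj hp,
    ← coord_covec K hj hq]
  exact pairTwo_ι_mul_ι K _ _ _ _

omit [CharZero K] in
theorem coeffTwo_swap {x : ExteriorAlgebra K (ℕ →₀ K)} (hx : x ∈ LamDeg K 2) {i j : ℕ}
    (hi : 1 ≤ i) (hj : 1 ≤ j) : coeffTwo K i j x = -coeffTwo K j i x := by
  rw [LamDeg_two] at hx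
  induction hx using Submodule.span_induction with
  | zero => simp
  | add x y _ _ h h' => rw [map_add, map_add, h, h']; ring
  | smul c x _ h => rw [map_smul, map_smul, h, smul_neg]
  | mem x h =>
    obtain ⟨p, q, hp, hq, rfl⟩ := h
    rw [coeffTwo_e_mul_e K hi hj hp (by omega), coeffTwo_e_mul_e K hj hi hp (by omega)]
    ring

omit [CharZero K] in
/-- A combination of monomials `e^p ∧ e^q`, `(p, q) ∈ S`, vanishes if its coefficients do. -/
theorem eq_zero_of_coeffTwo {S : Set (ℕ × ℕ)} (hS : ∀ t ∈ S, 1 ≤ t.1 ∧ t.1 < t.2)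
    {x : ExteriorAlgebra K (ℕ →₀ K)}
    (hx : x ∈ Submodule.span K ((fun t : ℕ × ℕ => e K t.1 * e K t.2) '' S))
    (h : ∀ t ∈ S, coeffTwo K t.1 t.2 x = 0) : x = 0 := by
  obtain ⟨c, hc, rfl⟩ := (Finsupp.mem_span_image_iff_linearCombination K).mp hx
  suffices c = 0 by simp [this]
  ext t
  by_cases ht : t ∈ S
  · rw [Finsupp.zero_apply, ← h t ht, Finsupp.linearCombination_apply, Finsupp.sum, map_sum,
      Finset.sum_eq_single t]
    · obtain ⟨h1, h2⟩ := hS t ht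
      rw [map_smul, coeffTwo_e_mul_e K h1 (by omega) h1 (by omega)]
      simp [h2.ne]
    · intro s hs hst
      obtain ⟨h1, h2⟩ := hS t ht
      obtain ⟨h3, h4⟩ := hS s (hc hs)
      rw [map_smul, coeffTwo_e_mul_e K h1 (by omega) h3 (by omega)]
      have : ¬ (s.1 = t.1 ∧ s.2 = t.2) := fun hh => hst (Prod.ext hh.1 hh.2)
      split_ifs <;> first | omega | simp
    · intro ht'
      simp [Finsupp.notMem_support_iff.mp ht']
  · by_contra hne
    exact ht (hc (Finsupp.mem_support_iff.mpr hne))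

/-- The hypotheses pinning down the Chevalley–Eilenberg differential in low degree. -/
structure IsDifferential (d : Module.End K (ExteriorAlgebra K (ℕ →₀ K))) : Prop where
  apply_e : ∀ p, 1 ≤ p → d (e K p) =
    e K 1 * ExteriorAlgebra.ι K (adOneDual K p) + e K 2 * ExteriorAlgebra.ι K (adTwoDual K p)
  apply_e_mul : ∀ p, 1 ≤ p → ∀ y, d (e K p * y) = d (e K p) * y - e K p * d y

variable {d : Module.End K (ExteriorAlgebra K (ℕ →₀ K))}

omit [CharZero K] in
theorem coeffTwo_d_of_mem_LamDeg_one (hd : IsDifferential K d)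
    {x : ExteriorAlgebra K (ℕ →₀ K)} (hx : x ∈ LamDeg K 1) :
    coeffTwo K 1 4 (d x) = coeffTwo K 2 3 (d x) ∧ coeffTwo K 3 4 (d x) = 0 := by
  rw [LamDeg_one] at hx
  induction hx using Submodule.span_induction with
  | zero => simp
  | add x y _ _ h h' => simp only [map_add, h.1, h'.1, h.2, h'.2, add_zero, and_self]
  | smul c x _ h => simp only [map_smul, h.1, h.2, smul_zero, and_self]
  | mem x h =>
    obtain ⟨p, hp, rfl⟩ := h
    rw [hd.apply_e p hp]
    simp only [e, coeffTwo, map_add, pairTwo_ι_mul_ι, ← covec.eq_1]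
    simp [coord_adOneDual K _ hp, coord_adTwoDual K _ hp, coord_covec]

omit [CharZero K] in
theorem d_e_mul_e (hd : IsDifferential K d) {p q : ℕ} (hp : 1 ≤ p) (hq : 1 ≤ q) :
    d (e K p * e K q) =
      e K 1 * ExteriorAlgebra.ι K (adOneDual K p) * e K q +
      e K 2 * ExteriorAlgebra.ι K (adTwoDual K p) * e K q -
      e K p * e K 1 * ExteriorAlgebra.ι K (adOneDual K q) -
      e K p * e K 2 * ExteriorAlgebra.ι K (adTwoDual K q) := by
  rw [hd.apply_e_mul p hp, hd.apply_e p hp, hd.apply_e q hq]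
  noncomm_ring

/-- The coefficient of `e^i ∧ e^j ∧ e^k`. -/
noncomputable def coeffThree (i j k : ℕ) : ExteriorAlgebra K (ℕ →₀ K) →ₗ[K] K :=
  pairThree K (coord K i) (coord K j) (coord K k)

omit [CharZero K] in
theorem coeffThree_d_e_mul_e (hd : IsDifferential K d) {i j k p q : ℕ} (hp : 1 ≤ p)
    (hq : 1 ≤ q) :
    coeffThree K i j k (d (e K p * e K q)) =
      pairThree K (coord K i) (coord K j) (coord K k) (ExteriorAlgebra.ι K (covec K 1) *
        ExteriorAlgebra.ι K (adOneDual K p) * ExteriorAlgebra.ι K (covec K q)) +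
      pairThree K (coord K i) (coord K j) (coord K k) (ExteriorAlgebra.ι K (covec K 2) *
        ExteriorAlgebra.ι K (adTwoDual K p) * ExteriorAlgebra.ι K (covec K q)) -
      pairThree K (coord K i) (coord K j) (coord K k) (ExteriorAlgebra.ι K (covec K p) *
        ExteriorAlgebra.ι K (covec K 1) * ExteriorAlgebra.ι K (adOneDual K q)) -
      pairThree K (coord K i) (coord K j) (coord K k) (ExteriorAlgebra.ι K (covec K p) *
        ExteriorAlgebra.ι K (covec K 2) * ExteriorAlgebra.ι K (adTwoDual K q)) := by
  rw [d_e_mul_e K hd hp hq, map_sub, map_sub, map_add]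
  rfl

omit [CharZero K] in
theorem coeffThree_one_d (hd : IsDifferential K d) {x : ExteriorAlgebra K (ℕ →₀ K)}
    (hx : x ∈ LamDeg K 2) {i j : ℕ} (hi : 3 ≤ i) (hj : 3 ≤ j) :
    coeffThree K 1 i j (d x) = coeffTwo K (i + 1) j x + coeffTwo K i (j + 1) x := by
  rw [LamDeg_two] at hx
  induction hx using Submodule.span_induction with
  | zero => simp
  | add x y _ _ h h' => simp only [map_add, h, h']; ring
  | smul c x _ h => simp only [map_smul, h, smul_eq_mul]; ring
  | mem x h =>
    obtain ⟨p, q, hp, hpq, rfl⟩ := h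
    have hq : 1 ≤ q := by omega
    have hi1 : 1 ≤ i ∧ 2 ≤ i ∧ 1 ≠ i ∧ 2 ≠ i := by omega
    have hj1 : 1 ≤ j ∧ 2 ≤ j ∧ 1 ≠ j ∧ 2 ≠ j := by omega
    rw [coeffThree_d_e_mul_e K hd hp hq]
    simp only [pairThree_ι_mul_ι_mul_ι, coeffTwo_e_mul_e, coord_adOneDual, coord_adTwoDual,
      coord_covec, *, le_refl, Nat.one_le_ofNat, Nat.le_add_left, if_true, if_false]
    norm_num
    ring

omit [CharZero K] in
theorem coeffThree_two_d (hd : IsDifferential K d) {x : ExteriorAlgebra K (ℕ →₀ K)}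
    (hx : x ∈ LamDeg K 2) {i j : ℕ} (hi : 3 ≤ i) (hj : 3 ≤ j) :
    coeffThree K 2 i j (d x) = coeffTwo K (i + 2) j x + coeffTwo K i (j + 2) x := by
  rw [LamDeg_two] at hx
  induction hx using Submodule.span_induction with
  | zero => simp
  | add x y _ _ h h' => simp only [map_add, h, h']; ring
  | smul c x _ h => simp only [map_smul, h, smul_eq_mul]; ring
  | mem x h =>
    obtain ⟨p, q, hp, hpq, rfl⟩ := h
    have hq : 1 ≤ q := by omega
    have hi1 : 1 ≤ i ∧ 2 ≤ i ∧ 1 ≠ i ∧ 2 ≠ i := by omega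
    have hj1 : 1 ≤ j ∧ 2 ≤ j ∧ 1 ≠ j ∧ 2 ≠ j := by omega
    rw [coeffThree_d_e_mul_e K hd hp hq]
    simp only [pairThree_ι_mul_ι_mul_ι, coeffTwo_e_mul_e, coord_adOneDual, coord_adTwoDual,
      coord_covec, *, le_refl, Nat.one_le_ofNat, Nat.le_add_left, if_true, if_false]
    norm_num
    ring

omit [CharZero K] in
theorem coeffThree_one_two_d (hd : IsDifferential K d) {x : ExteriorAlgebra K (ℕ →₀ K)}
    (hx : x ∈ LamDeg K 2) {j : ℕ} (hj : 3 ≤ j) :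
    coeffThree K 1 2 j (d x) =
      coeffTwo K 3 j x + coeffTwo K 2 (j + 1) x - coeffTwo K 1 (j + 2) x := by
  rw [LamDeg_two] at hx
  induction hx using Submodule.span_induction with
  | zero => simp
  | add x y _ _ h h' => simp only [map_add, h, h']; ring
  | smul c x _ h => simp only [map_smul, h, smul_eq_mul]; ring
  | mem x h =>
    obtain ⟨p, q, hp, hpq, rfl⟩ := h
    have hq : 1 ≤ q := by omega
    have hj1 : 1 ≤ j ∧ 2 ≤ j ∧ 1 ≠ j ∧ 2 ≠ j := by omega
    rw [coeffThree_d_e_mul_e K hd hp hq]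
    simp only [pairThree_ι_mul_ι_mul_ι, coeffTwo_e_mul_e, coord_adOneDual, coord_adTwoDual,
      coord_covec, *, le_refl, Nat.one_le_ofNat, Nat.le_add_left, if_true, if_false]
    norm_num
    ring

theorem coeffTwo_eq_zero_of_d_eq_zero (hd : IsDifferential K d)
    {x : ExteriorAlgebra K (ℕ →₀ K)} (hx : x ∈ LamDeg K 2) (hdx : d x = 0) {i j : ℕ}
    (hi : 3 ≤ i) (hj : 5 ≤ j) : coeffTwo K i j x = 0 := by
  obtain ⟨j, rfl⟩ := Nat.exists_eq_add_of_le' hj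
  have h1 := coeffThree_one_d K hd hx hi (show 3 ≤ j + 4 by omega)
  have h2 := coeffThree_one_d K hd hx (show 3 ≤ i + 1 by omega) (show 3 ≤ j + 3 by omega)
  have h3 := coeffThree_two_d K hd hx hi (show 3 ≤ j + 3 by omega)
  rw [hdx, map_zero] at h1 h2 h3
  have h : (2 : K) * coeffTwo K i (j + 5) x = 0 := by linear_combination h2 - h1 - h3
  simpa using h

/-- Monomials whose span complements the cocycles among the `2`-cochains. -/
def complementIndices : Set (ℕ × ℕ) :=
  {t | 2 ≤ t.1 ∧ t.1 < t.2 ∧ ¬ (t.1 = 2 ∧ t.2 = 3) ∧ ¬ (t.1 = 2 ∧ t.2 = 5)}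

/-- The span of the monomials indexed by `complementIndices`. -/
noncomputable def cochainComplement : Submodule K (ExteriorAlgebra K (ℕ →₀ K)) :=
  Submodule.span K ((fun t : ℕ × ℕ => e K t.1 * e K t.2) '' complementIndices)

omit [CharZero K] in
theorem e_mul_e_mem_LamDeg_two {p q : ℕ} (hp : 1 ≤ p) (hpq : p < q) :
    e K p * e K q ∈ LamDeg K 2 := by
  rw [LamDeg_two]
  exact Submodule.subset_span ⟨p, q, hp, hpq, rfl⟩

omit [CharZero K] in
theorem e_mem_LamDeg_one {p : ℕ} (hp : 1 ≤ p) : e K p ∈ LamDeg K 1 := by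
  rw [LamDeg_one]
  exact Submodule.subset_span ⟨p, hp, rfl⟩

omit [CharZero K] in
theorem cochainComplement_le : cochainComplement K ≤ LamDeg K 2 := by
  refine Submodule.span_le.mpr ?_
  rintro _ ⟨t, ht, rfl⟩
  obtain ⟨h1, h2, -, -⟩ := ht
  exact e_mul_e_mem_LamDeg_two K (by omega) h2

omit [CharZero K] in
theorem coeffTwo_of_mem_cochainComplement {x : ExteriorAlgebra K (ℕ →₀ K)}
    (hx : x ∈ cochainComplement K) {i j : ℕ} (hi : 1 ≤ i) (hij : i ≤ j)
    (h : (i, j) ∉ complementIndices) : coeffTwo K i j x = 0 := by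
  induction hx using Submodule.span_induction with
  | zero => simp
  | add x y _ _ h h' => rw [map_add, h, h', add_zero]
  | smul c x _ h => rw [map_smul, h, smul_zero]
  | mem x hx =>
    obtain ⟨t, ht, rfl⟩ := hx
    obtain ⟨h1, h2, -, -⟩ := id ht
    rw [coeffTwo_e_mul_e K hi (by omega) (by omega) (by omega)]
    have : ¬ (t.1 = i ∧ t.2 = j) := fun hh => h (by rwa [← hh.1, ← hh.2])
    split_ifs <;> first | omega | simp

theorem eq_zero_of_mem_cochainComplement (hd : IsDifferential K d)
    {x : ExteriorAlgebra K (ℕ →₀ K)} (hx : x ∈ cochainComplement K) (hdx : d x = 0) :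
    x = 0 := by
  have hx2 := cochainComplement_le K hx
  refine eq_zero_of_coeffTwo K (fun t ht => ⟨by linarith [ht.1], ht.2.1⟩) hx ?_
  have h1 : ∀ j, 1 ≤ j → coeffTwo K 1 j x = 0 := fun j hj =>
    coeffTwo_of_mem_cochainComplement K hx le_rfl hj (by simp [complementIndices])
  have h12 : ∀ j, 3 ≤ j → coeffTwo K 3 j x + coeffTwo K 2 (j + 1) x = 0 := by
    intro j hj
    have := coeffThree_one_two_d K hd hx2 hj
    rw [hdx, map_zero, h1 (j + 2) (by omega)] at this
    linear_combination -this
  rintro ⟨i, j⟩ ⟨hi, hij, h23, h25⟩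
  dsimp only at *
  rcases hi.lt_or_eq with hi | rfl
  · by_cases hj : 5 ≤ j
    · exact coeffTwo_eq_zero_of_d_eq_zero K hd hx2 hdx hi hj
    · obtain ⟨rfl, rfl⟩ : i = 3 ∧ j = 4 := by omega
      have := h12 4 (by norm_num)
      rwa [coeffTwo_of_mem_cochainComplement K hx (i := 2) (j := 5) (by norm_num) (by norm_num)
        (by simp [complementIndices]), add_zero] at this
  · obtain ⟨j, rfl⟩ : ∃ m, j = m + 1 := ⟨j - 1, by omega⟩
    have := h12 j (by omega)
    suffices h3 : coeffTwo K 3 j x = 0 by rwa [h3, zero_add] at this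
    by_cases hj : 5 ≤ j
    · exact coeffTwo_eq_zero_of_d_eq_zero K hd hx2 hdx le_rfl hj
    · obtain rfl : j = 3 := by omega
      exact coeffTwo_of_mem_cochainComplement K hx (by norm_num) le_rfl
        (by simp [complementIndices])

namespace IsDifferential

omit [CharZero K] in
theorem apply_e_add_two (hd : IsDifferential K d) {i : ℕ} (h2 : 2 ≤ i) (h3 : i ≤ 3) :
    d (e K (i + 1)) = e K 1 * e K i := by
  rw [hd.apply_e _ (by omega), adOneDual, adTwoDual, if_pos (by omega), if_neg (by omega)]
  simp [e, covec]

omit [CharZero K] in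
theorem apply_e_succ (hd : IsDifferential K d) {i : ℕ} (hi : 4 ≤ i) :
    d (e K (i + 1)) = e K 1 * e K i + e K 2 * e K (i - 1) := by
  rw [hd.apply_e _ (by omega), adOneDual, adTwoDual, if_pos (by omega), if_pos (by omega)]
  rfl

omit [CharZero K] in
theorem apply_e_eq_zero (hd : IsDifferential K d) {i : ℕ} (h1 : 1 ≤ i) (h2 : i ≤ 2) :
    d (e K i) = 0 := by
  rw [hd.apply_e _ h1, adOneDual, adTwoDual, if_neg (by omega), if_neg (by omega)]
  simp

omit [CharZero K] in
theorem d_e_two_mul_e_three (hd : IsDifferential K d) : d (e K 2 * e K 3) = 0 := by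
  rw [hd.apply_e_mul 2 (by norm_num), hd.apply_e_eq_zero K (by norm_num) le_rfl,
    hd.apply_e_add_two K le_rfl (by norm_num), e_mul_swap K 1 2]
  simp [← mul_assoc, e_mul_self_s17]

omit [CharZero K] in
theorem d_weight_seven (hd : IsDifferential K d) :
    d (e K 3 * e K 4 - e K 2 * e K 5) = 0 := by
  rw [map_sub, hd.apply_e_mul 2 (by norm_num), hd.apply_e_mul 3 (by norm_num),
    hd.apply_e_eq_zero K (by norm_num) le_rfl, hd.apply_e_add_two K le_rfl (by norm_num),
    hd.apply_e_add_two K (by norm_num) le_rfl, hd.apply_e_succ K le_rfl, e_mul_swap K 1 3,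
    mul_add, ← mul_assoc (e K 2) (e K 1), e_mul_swap K 2 1]
  simp [← mul_assoc, e_mul_self_s17]

omit [CharZero K] in
theorem d_d_e (hd : IsDifferential K d) {p : ℕ} (hp : 1 ≤ p) : d (d (e K p)) = 0 := by
  have h1 := hd.apply_e_eq_zero K le_rfl (by norm_num)
  have h2 := hd.apply_e_eq_zero K (i := 2) (by norm_num) le_rfl
  rcases le_or_gt p 2 with h | h
  · rw [hd.apply_e_eq_zero K hp h, map_zero]
  obtain ⟨i, rfl⟩ : ∃ i, p = i + 3 := ⟨p - 3, by omega⟩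
  match i with
  | 0 => simp [hd.apply_e_add_two K (i := 2), hd.apply_e_mul, h1, h2]
  | 1 => simp [hd.apply_e_add_two K (i := 3), hd.apply_e_add_two K (i := 2), hd.apply_e_mul, h1,
      ← mul_assoc, e_mul_self_s17]
  | 2 =>
    rw [hd.apply_e_succ K le_rfl, map_add, hd.d_e_two_mul_e_three]
    simp [hd.apply_e_add_two K (i := 3), hd.apply_e_mul, h1, ← mul_assoc, e_mul_self_s17]
  | i + 3 =>
    have h6 : d (e K (i + 3 + 3)) = e K 1 * e K (i + 5) + e K 2 * e K (i + 4) :=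
      hd.apply_e_succ K (i := i + 5) (by omega)
    have h5 : d (e K (i + 5)) = e K 1 * e K (i + 4) + e K 2 * e K (i + 3) :=
      hd.apply_e_succ K (i := i + 4) (by omega)
    have h4 : e K 2 * d (e K (i + 4)) = e K 2 * e K 1 * e K (i + 3) := by
      rcases Nat.eq_zero_or_pos i with rfl | hi
      · rw [hd.apply_e_add_two K (i := 3) (by norm_num) le_rfl, mul_assoc]
      · rw [hd.apply_e_succ K (i := i + 3) (by omega), mul_add, ← mul_assoc, ← mul_assoc,
          e_mul_self_s17, zero_mul, add_zero]
    rw [h6, map_add, hd.apply_e_mul _ le_rfl, hd.apply_e_mul _ (by norm_num), h1, h2, h5, h4,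
      e_mul_swap K 2 1]
    simp [mul_add, ← mul_assoc, e_mul_self_s17]

omit [CharZero K] in
theorem d_e_mem_LamDeg_two (hd : IsDifferential K d) {p : ℕ} (hp : 1 ≤ p) :
    d (e K p) ∈ LamDeg K 2 := by
  rcases le_or_gt p 2 with h | h
  · rw [hd.apply_e_eq_zero K hp h]
    exact zero_mem _
  obtain ⟨i, rfl⟩ : ∃ i, p = i + 1 := ⟨p - 1, by omega⟩
  rcases le_or_gt i 3 with h' | h'
  · rw [hd.apply_e_add_two K (by omega) h']
    exact e_mul_e_mem_LamDeg_two K le_rfl (by omega)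
  · rw [hd.apply_e_succ K h']
    exact add_mem (e_mul_e_mem_LamDeg_two K le_rfl (by omega))
      (e_mul_e_mem_LamDeg_two K (by norm_num) (by omega))

omit [CharZero K] in
theorem cocycles_ge (hd : IsDifferential K d) :
    Submodule.span K {e K 2 * e K 3, e K 3 * e K 4 - e K 2 * e K 5} ⊔ (LamDeg K 1).map d ≤
      LamDeg K 2 ⊓ LinearMap.ker d := by
  refine sup_le (Submodule.span_le.mpr ?_) ?_
  · rintro _ (rfl | rfl)
    · exact ⟨e_mul_e_mem_LamDeg_two K (by norm_num) (by norm_num), hd.d_e_two_mul_e_three K⟩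
    · exact ⟨sub_mem (e_mul_e_mem_LamDeg_two K (by norm_num) (by norm_num))
        (e_mul_e_mem_LamDeg_two K (by norm_num) (by norm_num)), hd.d_weight_seven K⟩
  · rw [LamDeg_one, Submodule.map_span_le]
    rintro _ ⟨p, hp, rfl⟩
    exact ⟨hd.d_e_mem_LamDeg_two K hp, hd.d_d_e K hp⟩

omit [CharZero K] in
theorem LamDeg_two_le (hd : IsDifferential K d) :
    LamDeg K 2 ≤ (Submodule.span K {e K 2 * e K 3, e K 3 * e K 4 - e K 2 * e K 5} ⊔
      (LamDeg K 1).map d) ⊔ cochainComplement K := by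
  set W := Submodule.span K {e K 2 * e K 3, e K 3 * e K 4 - e K 2 * e K 5} ⊔
    (LamDeg K 1).map d with hW
  have hdW : ∀ {p}, 1 ≤ p → d (e K p) ∈ W ⊔ cochainComplement K := fun hp =>
    Submodule.mem_sup_left (Submodule.mem_sup_right
      (Submodule.mem_map_of_mem (e_mem_LamDeg_one K hp)))
  have hsW : ∀ {x}, x ∈ ({e K 2 * e K 3, e K 3 * e K 4 - e K 2 * e K 5} : Set _) →
      x ∈ W ⊔ cochainComplement K := fun hx =>
    Submodule.mem_sup_left (Submodule.mem_sup_left (Submodule.subset_span hx))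
  have hc : ∀ {p q}, (p, q) ∈ complementIndices → e K p * e K q ∈ W ⊔ cochainComplement K :=
    fun {p q} h => Submodule.mem_sup_right (Submodule.subset_span ⟨(p, q), h, rfl⟩)
  have htwo : ∀ {p q}, 2 ≤ p → p < q → e K p * e K q ∈ W ⊔ cochainComplement K := by
    intro p q hp hpq
    by_cases h : p = 2 ∧ q = 3
    · rw [h.1, h.2]
      exact hsW (by simp)
    by_cases h' : p = 2 ∧ q = 5
    · rw [h'.1, h'.2, ← sub_sub_cancel (e K 3 * e K 4) (e K 2 * e K 5)]
      exact sub_mem (hc (by simp [complementIndices])) (hsW (by simp))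
    · exact hc ⟨hp, hpq, h, h'⟩
  rw [LamDeg_two, Submodule.span_le]
  rintro _ ⟨p, q, hp, hpq, rfl⟩
  rcases hp.lt_or_eq with hp | rfl
  · exact htwo hp hpq
  rcases le_or_gt q 3 with h | h
  · rw [← hd.apply_e_add_two K hpq h]
    exact hdW (by omega)
  · rw [eq_sub_of_add_eq (hd.apply_e_succ K h).symm]
    exact sub_mem (hdW (by omega)) (htwo le_rfl (by omega))

theorem cocycles_le (hd : IsDifferential K d) :
    LamDeg K 2 ⊓ LinearMap.ker d ≤
      Submodule.span K {e K 2 * e K 3, e K 3 * e K 4 - e K 2 * e K 5} ⊔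
        (LamDeg K 1).map d := by
  rintro x ⟨hx, hdx⟩
  obtain ⟨w, hw, s, hs, rfl⟩ := Submodule.mem_sup.mp (hd.LamDeg_two_le K hx)
  have hdw : d w = 0 := (hd.cocycles_ge K hw).2
  have hds : d s = 0 := by
    have : d (w + s) = 0 := hdx
    rwa [map_add, hdw, zero_add] at this
  rwa [eq_zero_of_mem_cochainComplement K hd hs hds, add_zero]

end IsDifferential

omit [CharZero K] in
theorem coeffTwo_two_three (a b : K) :
    coeffTwo K 2 3 (a • (e K 2 * e K 3) + b • (e K 3 * e K 4 - e K 2 * e K 5)) = a := by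
  simp [coeffTwo_e_mul_e]

omit [CharZero K] in
theorem coeffTwo_three_four (a b : K) :
    coeffTwo K 3 4 (a • (e K 2 * e K 3) + b • (e K 3 * e K 4 - e K 2 * e K 5)) = b := by
  simp [coeffTwo_e_mul_e]

omit [CharZero K] in
theorem coeffTwo_one_four (a b : K) :
    coeffTwo K 1 4 (a • (e K 2 * e K 3) + b • (e K 3 * e K 4 - e K 2 * e K 5)) = 0 := by
  simp [coeffTwo_e_mul_e]

/-- `H^2(m₂)` is two-dimensional, spanned by the classes of the cocycles
`e^2 ∧ e^3` (weight 5) and `e^3 ∧ e^4 - e^2 ∧ e^5` (weight 7).  Here `d` is the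
Chevalley–Eilenberg differential of `m₂` (`[e_1,e_i] = e_{i+1}` for `i ≥ 2`,
`[e_2,e_j] = e_{j+2}` for `j ≥ 3`): the 2-cocycles `Λ^2 ∩ ker d` are the direct sum of
the span of these two cocycles and the 2-coboundaries `d(Λ^1)`. -/
theorem stmt17 (d : Module.End K (ExteriorAlgebra K (ℕ →₀ K)))
    (hLeib : ∀ p : ℕ, ∀ x ∈ LamDeg K p, ∀ y,
      d (x * y) = d x * y + ((-1 : K) ^ p) • (x * d y))
    (h1 : d (e K 1) = 0) (h2 : d (e K 2) = 0)
    (h3 : d (e K 3) = e K 1 * e K 2)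
    (h4 : d (e K 4) = e K 1 * e K 3)
    (hd : ∀ i, 4 ≤ i → d (e K (i + 1)) = e K 1 * e K i + e K 2 * e K (i - 1)) :
    d (e K 2 * e K 3) = 0 ∧
    d (e K 3 * e K 4 - e K 2 * e K 5) = 0 ∧
    LinearIndependent K ![e K 2 * e K 3, e K 3 * e K 4 - e K 2 * e K 5] ∧
    LamDeg K 2 ⊓ LinearMap.ker d =
      Submodule.span K {e K 2 * e K 3, e K 3 * e K 4 - e K 2 * e K 5} ⊔
        (LamDeg K 1).map d ∧
    Submodule.span K {e K 2 * e K 3, e K 3 * e K 4 - e K 2 * e K 5} ⊓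
      (LamDeg K 1).map d = ⊥ := by
  have hD : IsDifferential K d := by
    refine ⟨fun p hp => ?_, fun p hp y => ?_⟩
    · match p, hp with
      | 1, _ => simp [h1, adOneDual, adTwoDual]
      | 2, _ => simp [h2, adOneDual, adTwoDual]
      | 3, _ => rw [h3]; simp [adOneDual, adTwoDual, e, covec]
      | 4, _ => rw [h4]; simp [adOneDual, adTwoDual, e, covec]
      | i + 5, _ =>
        rw [hd (i + 4) (by omega), adOneDual, adTwoDual, if_pos (by omega), if_pos (by omega)]
        rfl
    · rw [hLeib 1 _ (e_mem_LamDeg_one K hp), pow_one, neg_one_smul, sub_eq_add_neg]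
  refine ⟨hD.d_e_two_mul_e_three K, hD.d_weight_seven K, ?_,
    le_antisymm (hD.cocycles_le K) (hD.cocycles_ge K), ?_⟩
  · rw [LinearIndependent.pair_iff]
    intro a b h
    have ha := coeffTwo_two_three K a b
    have hb := coeffTwo_three_four K a b
    rw [h, map_zero] at ha hb
    exact ⟨ha.symm, hb.symm⟩
  · rw [eq_bot_iff]
    rintro x ⟨hx, y, hy, rfl⟩
    obtain ⟨a, b, hab⟩ := Submodule.mem_span_pair.mp hx
    obtain ⟨h14, h34⟩ := coeffTwo_d_of_mem_LamDeg_one K hD hy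
    rw [← hab] at h14 h34 ⊢
    rw [coeffTwo_one_four, coeffTwo_two_three] at h14
    rw [coeffTwo_three_four] at h34
    simp [← h14, h34]
end
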